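/- arXiv:0804.2794 — 6 statements merged into one kernel-verified Lean document; each statement's English description precedes it below -/
import Mathlib

section
/- Let 𝔤 be a real Lie algebra equipped with a symmetric bilinear form g : 𝔤 × 𝔤 → ℝ that is invariant (a Killing metric), i.e. g(⁅x,y⁆,z) + g(y,⁅x,z⁆) = 0 for all x,y,z ∈ 𝔤, and a linear map J : 𝔤 → 𝔤 with J(J x) = −x and g(J x, J y) = −g(x,y) for all x,y ∈ 𝔤. Define F(x,y,z) := (1/2)·(g(⁅x, J y⁆, z) − g(⁅x,y⁆, J z)). Then the cyclic sum F(x,y,z) + F(y,z,x) + F(z,x,y) = 0 holds for all x,y,z ∈ 𝔤 (the quasi-Kähler, i.e. W₃, condition). -/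
/-- Theorem 2.1(i): a Lie algebra with an invariant (Killing) Norden metric and a
compatible almost complex structure satisfies the quasi-Kähler (W₃) condition:
the cyclic sum of F(x,y,z) = (1/2)(g([x,Jy],z) − g([x,y],Jz)) vanishes. -/
theorem quasi_Kaehler_of_Killing_Norden
    (L : Type*) [LieRing L] [LieAlgebra ℝ L]
    (g : L →ₗ[ℝ] L →ₗ[ℝ] ℝ)
    (hsym : ∀ x y : L, g x y = g y x)
    (hinv : ∀ x y z : L, g ⁅x, y⁆ z + g y ⁅x, z⁆ = 0)
    (J : L →ₗ[ℝ] L)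
    (hJ2 : ∀ x : L, J (J x) = -x)
    (hJg : ∀ x y : L, g (J x) (J y) = -g x y)
    (F : L → L → L → ℝ)
    (hF : ∀ x y z : L, F x y z = (1/2 : ℝ) * (g ⁅x, J y⁆ z - g ⁅x, y⁆ (J z))) :
    ∀ x y z : L, F x y z + F y z x + F z x y = 0 := by
  have hcyc (a b c : L) : g ⁅a, b⁆ c = g ⁅b, c⁆ a := by
    have h := hinv b a c
    rw [← lie_skew b a, map_neg, LinearMap.neg_apply, hsym a] at h
    linarith
  intro x y z
  rw [hF, hF, hF, hcyc x y (J z), hcyc y z (J x), hcyc z x (J y)]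
  ring
end

section
/- Let λ₁, λ₂, λ₃ ∈ ℝ and let [·,·] be the Table 1 bracket on ℝ⁶. Then [·,·] satisfies the Jacobi identity [[x,y],z] + [[y,z],x] + [[z,x],y] = 0 for all x,y,z ∈ ℝ⁶, so (ℝ⁶, [·,·]) is a real Lie algebra (for every choice of the three parameters). -/
noncomputable section

open Finset

/-- Component `k` of the Table 1 bracket `[e_i, e_j]` (indices 0–5 for e₁–e₆). -/
def tbl (l1 l2 l3 : ℝ) : Fin 6 → Fin 6 → Fin 6 → ℝ :=
  let v12 : Fin 6 → ℝ := ![0, 0, 0, l2, l3, 0]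
  let v13 : Fin 6 → ℝ := ![0, 0, 0, -l1, 0, -l3]
  let v14 : Fin 6 → ℝ := ![0, l2, -l1, 0, l2, -l1]
  let v15 : Fin 6 → ℝ := ![0, l3, 0, -l2, 0, 0]
  let v16 : Fin 6 → ℝ := ![0, 0, -l3, l1, 0, 0]
  let v23 : Fin 6 → ℝ := ![0, 0, 0, 0, l1, l2]
  let v24 : Fin 6 → ℝ := ![-l2, 0, 0, 0, l3, 0]
  let v25 : Fin 6 → ℝ := ![-l3, 0, l1, -l3, 0, l1]
  let v26 : Fin 6 → ℝ := ![0, 0, l2, 0, -l1, 0]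
  let v34 : Fin 6 → ℝ := ![l1, 0, 0, 0, 0, -l3]
  let v35 : Fin 6 → ℝ := ![0, -l1, 0, 0, 0, l2]
  let v36 : Fin 6 → ℝ := ![l3, -l2, 0, l3, -l2, 0]
  let v45 : Fin 6 → ℝ := ![-l2, -l3, 0, 0, 0, 0]
  let v46 : Fin 6 → ℝ := ![l1, 0, l3, 0, 0, 0]
  let v56 : Fin 6 → ℝ := ![0, -l1, -l2, 0, 0, 0]
  ![![0, v12, v13, v14, v15, v16],
    ![-v12, 0, v23, v24, v25, v26],
    ![-v13, -v23, 0, v34, v35, v36],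
    ![-v14, -v24, -v34, 0, v45, v46],
    ![-v15, -v25, -v35, -v45, 0, v56],
    ![-v16, -v26, -v36, -v46, -v56, 0]]

/-- The Table 1 bracket on ℝ⁶, extended bilinearly. -/
def br (l1 l2 l3 : ℝ) (x y : Fin 6 → ℝ) : Fin 6 → ℝ :=
  fun k => ∑ i : Fin 6, ∑ j : Fin 6, x i * y j * tbl l1 l2 l3 i j k

/-- The standard basis of ℝ⁶. -/
def e (i : Fin 6) : Fin 6 → ℝ := Pi.single i 1

/-- The signs of the Norden metric. -/
def eps : Fin 6 → ℝ := ![1, 1, 1, -1, -1, -1]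

/-- The Norden metric: diagonal with entries (1,1,1,-1,-1,-1). -/
def gN (x y : Fin 6 → ℝ) : ℝ := ∑ i : Fin 6, eps i * x i * y i

/-- The almost complex structure: J eᵢ = e_{i+3}, J e_{i+3} = −eᵢ (i = 1,2,3). -/
def JN (x : Fin 6 → ℝ) : Fin 6 → ℝ := ![-x 3, -x 4, -x 5, x 0, x 1, x 2]

/-- The fundamental tensor F(x,y,z) = g((∇ₓJ)y, z) with ∇ₓy = (1/2)[x,y]. -/
def FT (l1 l2 l3 : ℝ) (x y z : Fin 6 → ℝ) : ℝ :=
  (1/2 : ℝ) * (gN (br l1 l2 l3 x (JN y)) z - gN (br l1 l2 l3 x y) (JN z))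

/-- The (0,4)-curvature tensor R(x,y,z,u) = −(1/4)g([x,y],[z,u]). -/
def RT (l1 l2 l3 : ℝ) (x y z u : Fin 6 → ℝ) : ℝ :=
  -(1/4 : ℝ) * gN (br l1 l2 l3 x y) (br l1 l2 l3 z u)

/-- The Ricci tensor ρ(y,z) = Σᵢ εᵢ R(eᵢ,y,z,eᵢ). -/
def ricT (l1 l2 l3 : ℝ) (y z : Fin 6 → ℝ) : ℝ :=
  ∑ i : Fin 6, eps i * RT l1 l2 l3 (e i) y z (e i)

/-- The sectional curvature of the plane spanned by x, y. -/
def kT (l1 l2 l3 : ℝ) (x y : Fin 6 → ℝ) : ℝ :=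
  RT l1 l2 l3 x y y x / (gN x x * gN y y - gN x y ^ 2)

/-- The matrix of ad x : v ↦ [x,v]. -/
def adM (l1 l2 l3 : ℝ) (x : Fin 6 → ℝ) : Matrix (Fin 6) (Fin 6) ℝ :=
  Matrix.of fun k j => br l1 l2 l3 x (e j) k

/-- The Killing form B(x,y) = tr(ad x ∘ ad y). -/
def KB (l1 l2 l3 : ℝ) (x y : Fin 6 → ℝ) : ℝ :=
  Matrix.trace (adM l1 l2 l3 x * adM l1 l2 l3 y)

/-- The Table 1 bracket in coordinates, in terms of the minors `x i * y j - x j * y i`. -/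
theorem br_eq_minors (l1 l2 l3 : ℝ) (x y : Fin 6 → ℝ) :
    br l1 l2 l3 x y =
      let p : Fin 6 → Fin 6 → ℝ := fun i j => x i * y j - x j * y i
      ![-l2 * p 1 3 - l3 * p 1 4 + l1 * p 2 3 + l3 * p 2 5 - l2 * p 3 4 + l1 * p 3 5,
        l2 * p 0 3 + l3 * p 0 4 - l1 * p 2 4 - l2 * p 2 5 - l3 * p 3 4 - l1 * p 4 5,
        -l1 * p 0 3 - l3 * p 0 5 + l1 * p 1 4 + l2 * p 1 5 + l3 * p 3 5 - l2 * p 4 5,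
        l2 * p 0 1 - l1 * p 0 2 - l2 * p 0 4 + l1 * p 0 5 - l3 * p 1 4 + l3 * p 2 5,
        l3 * p 0 1 + l2 * p 0 3 + l1 * p 1 2 + l3 * p 1 3 - l1 * p 1 5 - l2 * p 2 5,
        -l3 * p 0 2 - l1 * p 0 3 + l2 * p 1 2 + l1 * p 1 4 - l3 * p 2 3 + l2 * p 2 4] := by
  funext k
  fin_cases k <;> simp [br, tbl, Fin.sum_univ_six] <;> ring

/-- The Table 1 bracket satisfies the Jacobi identity for every choice of
parameters λ₁, λ₂, λ₃, so (ℝ⁶, [·,·]) is a real Lie algebra. -/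
theorem table1_jacobi (l1 l2 l3 : ℝ) :
    ∀ x y z : Fin 6 → ℝ,
      br l1 l2 l3 (br l1 l2 l3 x y) z + br l1 l2 l3 (br l1 l2 l3 y z) x
        + br l1 l2 l3 (br l1 l2 l3 z x) y = 0 := by
  intro x y z
  simp only [br_eq_minors]
  funext k
  fin_cases k <;> simp <;> ring
end
end

section
/- Let λ₁, λ₂, λ₃ ∈ ℝ, let [·,·] be the Table 1 bracket on ℝ⁶, and let g be the Norden metric with g(eᵢ,eᵢ) = 1 for i = 1,2,3, g(eᵢ,eᵢ) = −1 for i = 4,5,6, g(eᵢ,eⱼ) = 0 for i ≠ j. Then g is invariant (a Killing metric) for the Table 1 bracket: g([x,y],z) + g(y,[x,z]) = 0 for all x,y,z ∈ ℝ⁶. -/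
noncomputable section

open Finset

set_option maxHeartbeats 2000000 in
/-- Invariance of the metric on basis vectors: the structure constants with lowered last index are
skew in the last two indices. -/
lemma eps_mul_tbl_skew (l1 l2 l3 : ℝ) (i j k : Fin 6) :
    eps k * tbl l1 l2 l3 i j k + eps j * tbl l1 l2 l3 i k j = 0 := by
  fin_cases i <;> fin_cases j <;> fin_cases k <;> simp [eps, tbl]

/-- The trilinear form `g([x,y],z)` in terms of structure constants. -/
lemma gN_br_left (l1 l2 l3 : ℝ) (x y z : Fin 6 → ℝ) :
    gN (br l1 l2 l3 x y) z =
      ∑ i, ∑ j, ∑ k, x i * y j * z k * (eps k * tbl l1 l2 l3 i j k) := by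
  simp only [gN, br, mul_sum, sum_mul]
  rw [sum_comm]
  refine sum_congr rfl fun i _ => ?_
  rw [sum_comm]
  exact sum_congr rfl fun j _ => sum_congr rfl fun k _ => by ring

lemma gN_comm (x y : Fin 6 → ℝ) : gN x y = gN y x :=
  sum_congr rfl fun i _ => by ring

/-- The Norden metric g is invariant (a Killing metric) for the Table 1 bracket:
g([x,y],z) + g(y,[x,z]) = 0 for all x, y, z. -/
theorem table1_killing_metric (l1 l2 l3 : ℝ) :
    ∀ x y z : Fin 6 → ℝ,
      gN (br l1 l2 l3 x y) z + gN y (br l1 l2 l3 x z) = 0 := by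
  intro x y z
  rw [gN_comm y, gN_br_left, gN_br_left, ← sum_add_distrib]
  refine sum_eq_zero fun i _ => ?_
  rw [sum_comm (f := fun j k => x i * z j * y k * (eps k * tbl l1 l2 l3 i j k)),
    ← sum_add_distrib]
  refine sum_eq_zero fun j _ => ?_
  rw [← sum_add_distrib]
  refine sum_eq_zero fun k _ => ?_
  linear_combination x i * y j * z k * eps_mul_tbl_skew l1 l2 l3 i j k
end
end

section
/- Let λ₁, λ₂, λ₃ ∈ ℝ, let [·,·] be the Table 1 bracket on ℝ⁶, g the Norden metric, J the almost complex structure with Jeᵢ = e_{i+3}, Je_{i+3} = −eᵢ for i = 1,2,3, and define F(x,y,z) := (1/2)·(g([x, J y], z) − g([x,y], J z)). Then F(x,y,z) + F(y,z,x) + F(z,x,y) = 0 for all x,y,z ∈ ℝ⁶; that is, the associated 6-dimensional almost Norden manifold is a quasi-Kähler (W₃) manifold. -/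
noncomputable section

open Finset

/-- The components of the Table 1 bracket, in terms of the Plücker coordinates of `x` and `y`. -/
theorem br_eq (l1 l2 l3 : ℝ) (x y : Fin 6 → ℝ) :
    br l1 l2 l3 x y = ![
      -l2 * (x 1 * y 3 - x 3 * y 1) - l3 * (x 1 * y 4 - x 4 * y 1)
        + l1 * (x 2 * y 3 - x 3 * y 2) + l3 * (x 2 * y 5 - x 5 * y 2)
        - l2 * (x 3 * y 4 - x 4 * y 3) + l1 * (x 3 * y 5 - x 5 * y 3),
      l2 * (x 0 * y 3 - x 3 * y 0) + l3 * (x 0 * y 4 - x 4 * y 0)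
        - l1 * (x 2 * y 4 - x 4 * y 2) - l2 * (x 2 * y 5 - x 5 * y 2)
        - l3 * (x 3 * y 4 - x 4 * y 3) - l1 * (x 4 * y 5 - x 5 * y 4),
      -l1 * (x 0 * y 3 - x 3 * y 0) - l3 * (x 0 * y 5 - x 5 * y 0)
        + l1 * (x 1 * y 4 - x 4 * y 1) + l2 * (x 1 * y 5 - x 5 * y 1)
        + l3 * (x 3 * y 5 - x 5 * y 3) - l2 * (x 4 * y 5 - x 5 * y 4),
      l2 * (x 0 * y 1 - x 1 * y 0) - l1 * (x 0 * y 2 - x 2 * y 0)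
        - l2 * (x 0 * y 4 - x 4 * y 0) + l1 * (x 0 * y 5 - x 5 * y 0)
        - l3 * (x 1 * y 4 - x 4 * y 1) + l3 * (x 2 * y 5 - x 5 * y 2),
      l3 * (x 0 * y 1 - x 1 * y 0) + l2 * (x 0 * y 3 - x 3 * y 0)
        + l1 * (x 1 * y 2 - x 2 * y 1) + l3 * (x 1 * y 3 - x 3 * y 1)
        - l1 * (x 1 * y 5 - x 5 * y 1) - l2 * (x 2 * y 5 - x 5 * y 2),
      -l3 * (x 0 * y 2 - x 2 * y 0) - l1 * (x 0 * y 3 - x 3 * y 0)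
        + l2 * (x 1 * y 2 - x 2 * y 1) + l1 * (x 1 * y 4 - x 4 * y 1)
        - l3 * (x 2 * y 3 - x 3 * y 2) + l2 * (x 2 * y 4 - x 4 * y 2)] := by
  ext k
  fin_cases k <;> simp [br, tbl, Fin.sum_univ_succ] <;> ring

/-- The 'if' direction of Theorem 3.1: for the Table 1 bracket, the fundamental tensor
F satisfies the cyclic condition F(x,y,z) + F(y,z,x) + F(z,x,y) = 0, i.e. the
associated 6-dimensional almost Norden manifold is quasi-Kähler (of class W₃). -/
theorem table1_quasi_Kaehler (l1 l2 l3 : ℝ) :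
    ∀ x y z : Fin 6 → ℝ,
      FT l1 l2 l3 x y z + FT l1 l2 l3 y z x + FT l1 l2 l3 z x y = 0 := by
  intro x y z
  simp only [FT, gN, JN, br_eq, eps, Fin.sum_univ_six, Matrix.cons_val]
  ring
end
end

section
/- Let λ₁, λ₂, λ₃ ∈ ℝ and let [·,·] be the Table 1 bracket on ℝ⁶. Define the Killing form B(x,y) := tr(ad x ∘ ad y), where ad x : v ↦ [x,v]. Then the matrix (B(eᵢ,eⱼ)) is the 6×6 block matrix 4·[[L, −L],[−L, L]], where L is the 3×3 matrix with rows (λ₃², −λ₂λ₃, −λ₁λ₃), (−λ₂λ₃, λ₂², −λ₁λ₂), (−λ₁λ₃, −λ₁λ₂, λ₁²). -/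
noncomputable section

open Finset

/-- The bracket of two basis vectors has the structure constants as its components. -/
theorem br_e_e (l1 l2 l3 : ℝ) (i j k : Fin 6) :
    br l1 l2 l3 (e i) (e j) k = tbl l1 l2 l3 i j k := by
  simp [br, e, Pi.single_apply]

/-- The Killing form of two basis vectors in terms of the structure constants. -/
theorem KB_e_e (l1 l2 l3 : ℝ) (i j : Fin 6) :
    KB l1 l2 l3 (e i) (e j) =
      ∑ k : Fin 6, ∑ m : Fin 6, tbl l1 l2 l3 i m k * tbl l1 l2 l3 j k m := by
  simp [KB, adM, Matrix.trace, Matrix.mul_apply, br_e_e]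

/-- The Killing form of the Table 1 Lie algebra in the basis e₁,…,e₆ is the block
matrix 4·[[L, −L], [−L, L]] with L as in the paper. -/
theorem table1_killing_form (l1 l2 l3 : ℝ) :
    (Matrix.of fun i j : Fin 6 => KB l1 l2 l3 (e i) (e j)) =
      (4 : ℝ) • (Matrix.reindex finSumFinEquiv finSumFinEquiv
        (Matrix.fromBlocks
          !![l3^2, -l2*l3, -l1*l3; -l2*l3, l2^2, -l1*l2; -l1*l3, -l1*l2, l1^2]
          (-!![l3^2, -l2*l3, -l1*l3; -l2*l3, l2^2, -l1*l2; -l1*l3, -l1*l2, l1^2])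
          (-!![l3^2, -l2*l3, -l1*l3; -l2*l3, l2^2, -l1*l2; -l1*l3, -l1*l2, l1^2])
          !![l3^2, -l2*l3, -l1*l3; -l2*l3, l2^2, -l1*l2; -l1*l3, -l1*l2, l1^2])) := by
  ext i j
  obtain ⟨i, rfl⟩ := (finSumFinEquiv (m := 3) (n := 3)).surjective i
  obtain ⟨j, rfl⟩ := (finSumFinEquiv (m := 3) (n := 3)).surjective j
  rw [Matrix.of_apply, KB_e_e, Matrix.smul_apply, Matrix.reindex_apply, Matrix.submatrix_apply,
    Equiv.symm_apply_apply, Equiv.symm_apply_apply]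
  rcases i with i | i <;> rcases j with j | j <;> fin_cases i <;> fin_cases j <;>
    simp [tbl, Fin.sum_univ_succ, finSumFinEquiv, Fin.castAdd, Fin.natAdd] <;> ring
end
end

section
/- Let λ₁, λ₂, λ₃ ∈ ℝ and let [·,·] be the Table 1 bracket on ℝ⁶ with Killing form B(x,y) := tr(ad x ∘ ad y). Then B is degenerate; in fact B(eᵢ + e_{i+3}, y) = 0 for every y ∈ ℝ⁶ and every i ∈ {1,2,3}, and e₁ + e₄ ≠ 0 lies in the radical of B. -/
noncomputable section

open Finset

theorem adM_apply (l1 l2 l3 : ℝ) (x : Fin 6 → ℝ) (k j : Fin 6) :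
    adM l1 l2 l3 x k j = ∑ i : Fin 6, x i * tbl l1 l2 l3 i j k := by
  simp [adM, br, e, Pi.single_apply]

theorem KB_eq_sum (l1 l2 l3 : ℝ) (x y : Fin 6 → ℝ) :
    KB l1 l2 l3 x y = ∑ m : Fin 6, y m *
      ∑ k : Fin 6, ∑ j : Fin 6, adM l1 l2 l3 x k j * tbl l1 l2 l3 m k j := by
  simp only [KB, Matrix.trace, Matrix.diag, Matrix.mul_apply, adM_apply _ _ _ y, Finset.mul_sum]
  conv_rhs => rw [Finset.sum_comm]
  refine Finset.sum_congr rfl fun k _ => ?_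
  rw [Finset.sum_comm]
  exact Finset.sum_congr rfl fun m _ => Finset.sum_congr rfl fun j _ => by ring

theorem adM_e_add_e (l1 l2 l3 : ℝ) (a b k j : Fin 6) :
    adM l1 l2 l3 (e a + e b) k j = tbl l1 l2 l3 a j k + tbl l1 l2 l3 b j k := by
  simp [adM_apply, e, add_mul, Finset.sum_add_distrib, Pi.single_apply]

theorem KB_e_add_e_eq_zero (l1 l2 l3 : ℝ) (a b : Fin 6)
    (h : ∀ m : Fin 6, ∑ k : Fin 6, ∑ j : Fin 6,
      (tbl l1 l2 l3 a j k + tbl l1 l2 l3 b j k) * tbl l1 l2 l3 m k j = 0) (y : Fin 6 → ℝ) :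
    KB l1 l2 l3 (e a + e b) y = 0 := by
  simp [KB_eq_sum, adM_e_add_e, h]

/-- The Killing form of the Table 1 Lie algebra is degenerate: B(eᵢ + e_{i+3}, ·) = 0
for i = 1,2,3, and the nonzero vector e₁ + e₄ lies in the radical of B. -/
theorem table1_killing_form_degenerate (l1 l2 l3 : ℝ) :
    (∀ y : Fin 6 → ℝ, KB l1 l2 l3 (e 0 + e 3) y = 0) ∧
    (∀ y : Fin 6 → ℝ, KB l1 l2 l3 (e 1 + e 4) y = 0) ∧
    (∀ y : Fin 6 → ℝ, KB l1 l2 l3 (e 2 + e 5) y = 0) ∧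
    e 0 + e 3 ≠ 0 := by
  refine ⟨KB_e_add_e_eq_zero l1 l2 l3 0 3 fun m => ?_,
    KB_e_add_e_eq_zero l1 l2 l3 1 4 fun m => ?_,
    KB_e_add_e_eq_zero l1 l2 l3 2 5 fun m => ?_, fun h => ?_⟩
  · fin_cases m <;> simp [tbl, Fin.sum_univ_six]
  · fin_cases m <;> simp [tbl, Fin.sum_univ_six]
  · fin_cases m <;> simp [tbl, Fin.sum_univ_six]
  · simpa [e] using congrFun h 0
end
end
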